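/- For every integer m ≥ 2, the conditional probability, given the σ-algebra generated by the events {j ∈ α} for 2 ≤ j < m, that both m ∈ α and m + 2 ∈ α equals (1 − 1/m)·(y_m(α)^2 − (1/(m+1))(1 − 1/m) y_m(α)^3). -/

import Mathlib

open MeasureTheory Filter Finset Asymptotics
open scoped Classical

/-- `y_m(α) = ∏_{j ∈ α, j < m} (1 - 1/j)` (empty product = 1). -/
noncomputable def hawkinsY (A : Set ℕ) (m : ℕ) : ℝ :=
  ∏ j ∈ Finset.range m, if j ∈ A then 1 - 1 / (j : ℝ) else 1

/-- The σ-algebra generated by the events `{j ∈ α}` for `2 ≤ j < m`. -/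
def sieveSigma {Ω : Type*} (α : Ω → Set ℕ) (m : ℕ) : MeasurableSpace Ω :=
  MeasurableSpace.generateFrom {s | ∃ j : ℕ, 2 ≤ j ∧ j < m ∧ s = {ω | j ∈ α ω}}

/-- Wunderlich's model of the Hawkins random sieve: a probability space `(Ω, μ)` with a
random subset `α` of `{2,3,4,…}` such that `μ(2 ∈ α) = 1` and, for every `m ≥ 2`, the
conditional probability of `{m ∈ α}` given the σ-algebra generated by the events
`{j ∈ α}`, `2 ≤ j < m`, equals `y_m(α)`. -/
structure IsHawkinsSieve {Ω : Type*} [MeasurableSpace Ω] (μ : Measure Ω)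
    (α : Ω → Set ℕ) : Prop where
  isProb : IsProbabilityMeasure μ
  meas : ∀ n : ℕ, MeasurableSet {ω | n ∈ α ω}
  mem_ge_two : ∀ ω, ∀ n ∈ α ω, 2 ≤ n
  two_mem : μ {ω | 2 ∈ α ω} = 1
  condExp_mem : ∀ m : ℕ, 2 ≤ m →
    μ[Set.indicator {ω | m ∈ α ω} (fun _ => (1 : ℝ)) | sieveSigma α m]
      =ᵐ[μ] fun ω => hawkinsY (α ω) m

/-- `M_k = 1 + ∑_{j=1}^{k-2} 1/j` (so `M_2 = 1`). -/
noncomputable def Mharm (k : ℕ) : ℝ := 1 + ∑ j ∈ Finset.Icc 1 (k - 2), 1 / (j : ℝ)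

theorem sieveSigma_mono {Ω : Type*} (α : Ω → Set ℕ) {m n : ℕ} (hmn : m ≤ n) :
    sieveSigma α m ≤ sieveSigma α n :=
  MeasurableSpace.generateFrom_mono fun _ ⟨j, hj, hjm, hs⟩ => ⟨j, hj, hjm.trans_le hmn, hs⟩

theorem measurableSet_sieveSigma {Ω : Type*} (α : Ω → Set ℕ) {j n : ℕ} (hj : 2 ≤ j)
    (hjn : j < n) : MeasurableSet[sieveSigma α n] {ω | j ∈ α ω} :=
  MeasurableSpace.measurableSet_generateFrom ⟨j, hj, hjn, rfl⟩

theorem measurable_indicator_mem_sieveSigma {Ω : Type*} (α : Ω → Set ℕ) {j n : ℕ}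
    (hj : 2 ≤ j) (hjn : j < n) :
    Measurable[sieveSigma α n] (Set.indicator {ω | j ∈ α ω} (fun _ => (1 : ℝ))) :=
  measurable_const.indicator (measurableSet_sieveSigma α hj hjn)

theorem hawkinsY_nonneg (A : Set ℕ) (m : ℕ) : 0 ≤ hawkinsY A m := by
  refine Finset.prod_nonneg fun j _ => ?_
  split_ifs
  · exact sub_nonneg.2 (by simpa using Nat.cast_inv_le_one (α := ℝ) j)
  · exact zero_le_one

theorem hawkinsY_le_one (A : Set ℕ) (m : ℕ) : hawkinsY A m ≤ 1 := by
  refine Finset.prod_le_one (fun j _ => ?_) fun j _ => ?_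
  · split_ifs
    · exact sub_nonneg.2 (by simpa using Nat.cast_inv_le_one (α := ℝ) j)
    · exact zero_le_one
  · split_ifs
    · exact sub_le_self _ (by positivity)
    · exact le_rfl

theorem hawkinsY_succ {Ω : Type*} (α : Ω → Set ℕ) (m : ℕ) (ω : Ω) :
    hawkinsY (α ω) (m + 1) = hawkinsY (α ω) m *
      (1 - 1 / (m : ℝ) * Set.indicator {ω | m ∈ α ω} (fun _ => (1 : ℝ)) ω) := by
  rw [hawkinsY, Finset.prod_range_succ, ← hawkinsY]
  by_cases hm : m ∈ α ω <;> simp [hm]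

namespace IsHawkinsSieve

variable {Ω : Type*} [MeasurableSpace Ω] {μ : Measure Ω} {α : Ω → Set ℕ}

theorem sieveSigma_le (h : IsHawkinsSieve μ α) (m : ℕ) :
    sieveSigma α m ≤ ‹MeasurableSpace Ω› :=
  MeasurableSpace.generateFrom_le fun _ ⟨j, _, _, hs⟩ => hs ▸ h.meas j

theorem measurable_hawkinsY (h : IsHawkinsSieve μ α) (m : ℕ) :
    Measurable[sieveSigma α m] fun ω => hawkinsY (α ω) m := by
  refine Finset.measurable_fun_prod _ fun j hj => ?_
  by_cases hj2 : 2 ≤ j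
  · exact Measurable.ite (measurableSet_sieveSigma α hj2 (Finset.mem_range.1 hj))
      measurable_const measurable_const
  · have : ∀ ω, j ∉ α ω := fun ω hω => hj2 (h.mem_ge_two ω j hω)
    simp [this]

/-- Under the conditional expectation given the sieve below `m ≤ n`, an affine function of the indicator of
`{n ∈ α}` may be replaced by the same affine function of `y_n(α)`. -/
theorem condExp_affine (h : IsHawkinsSieve μ α) {m n : ℕ} (hn : 2 ≤ n) (hmn : m ≤ n)
    {a b : Ω → ℝ} (ha : Measurable[sieveSigma α n] a) (hb : Measurable[sieveSigma α n] b)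
    {C D : ℝ} (haC : ∀ ω, |a ω| ≤ C) (hbD : ∀ ω, |b ω| ≤ D) :
    μ[fun ω => a ω + b ω * Set.indicator {ω | n ∈ α ω} (fun _ => (1 : ℝ)) ω | sieveSigma α m]
      =ᵐ[μ] μ[fun ω => a ω + b ω * hawkinsY (α ω) n | sieveSigma α m] := by
  have := h.isProb
  have hle := h.sieveSigma_le n
  have hI : Integrable (Set.indicator {ω | n ∈ α ω} (fun _ => (1 : ℝ))) μ :=
    (integrable_const 1).indicator (h.meas n)
  have hai : Integrable a μ :=
    Integrable.of_bound (ha.mono hle le_rfl).aestronglyMeasurable C (ae_of_all _ haC)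
  have hbI : Integrable (b * Set.indicator {ω | n ∈ α ω} (fun _ => (1 : ℝ))) μ :=
    hI.bdd_mul (hb.mono hle le_rfl).aestronglyMeasurable (ae_of_all _ hbD)
  have key : μ[a + b * Set.indicator {ω | n ∈ α ω} (fun _ => (1 : ℝ)) | sieveSigma α n]
      =ᵐ[μ] fun ω => a ω + b ω * hawkinsY (α ω) n := by
    filter_upwards [condExp_add hai hbI (sieveSigma α n),
      condExp_mul_of_stronglyMeasurable_left hb.stronglyMeasurable hbI hI,
      h.condExp_mem n hn] with ω h1 h2 h3
    rw [h1, Pi.add_apply, h2, Pi.mul_apply, h3,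
      condExp_of_stronglyMeasurable hle ha.stronglyMeasurable hai]
  exact (condExp_condExp_of_le (sieveSigma_mono α hmn) hle).symm.trans (condExp_congr_ae key)

end IsHawkinsSieve

theorem condProb_twin {Ω : Type*} [MeasurableSpace Ω] (μ : Measure Ω)
    (α : Ω → Set ℕ) (h : IsHawkinsSieve μ α) (m : ℕ) (hm : 2 ≤ m) :
    μ[Set.indicator {ω | m ∈ α ω ∧ m + 2 ∈ α ω} (fun _ => (1 : ℝ)) | sieveSigma α m]
      =ᵐ[μ] fun ω =>
        (1 - 1 / (m : ℝ)) *
          ((hawkinsY (α ω) m) ^ 2 -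
            (1 / ((m : ℝ) + 1)) * (1 - 1 / (m : ℝ)) * (hawkinsY (α ω) m) ^ 3) := by
  have := h.isProb
  set I : ℕ → Ω → ℝ := fun n => Set.indicator {ω | n ∈ α ω} (fun _ => (1 : ℝ)) with hIdef
  set Y : ℕ → Ω → ℝ := fun n ω => hawkinsY (α ω) n with hYdef
  set c : ℝ := 1 - 1 / (m : ℝ) with hc
  set d : ℝ := 1 / ((m : ℝ) + 1) with hd
  have hI01 : ∀ n ω, I n ω = 0 ∨ I n ω = 1 := fun n ω => by
    by_cases hn : n ∈ α ω <;> simp [hIdef, hn]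
  have hIabs : ∀ n ω, |I n ω| ≤ 1 := fun n ω => by
    rcases hI01 n ω with h0 | h0 <;> simp [h0]
  have hYabs : ∀ n ω, |Y n ω| ≤ 1 := fun n ω =>
    abs_le.2 ⟨by linarith [hawkinsY_nonneg (α ω) n], hawkinsY_le_one (α ω) n⟩
  have hImeas : Measurable[sieveSigma α (m + 1)] (I m) :=
    measurable_indicator_mem_sieveSigma α hm (Nat.lt_succ_self m)
  have hYmeas : Measurable[sieveSigma α m] (Y m) := h.measurable_hawkinsY m
  have hYmeas' : Measurable[sieveSigma α (m + 1)] (Y m) :=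
    hYmeas.mono (sieveSigma_mono α m.le_succ) le_rfl
  have hsucc : ∀ n ω, Y (n + 1) ω = Y n ω * (1 - 1 / (n : ℝ) * I n ω) :=
    fun n ω => hawkinsY_succ α n ω
  have hIY : ∀ ω, I m ω * Y (m + 1) ω = I m ω * (c * Y m ω) := fun ω => by
    rcases hI01 m ω with h0 | h0 <;> rw [hsucc, h0] <;> ring
  have e₁ : Set.indicator {ω | m ∈ α ω ∧ m + 2 ∈ α ω} (fun _ => (1 : ℝ))
      = fun ω => 0 + I m ω * I (m + 2) ω := by
    ext ω
    by_cases h₁ : m ∈ α ω <;> by_cases h₂ : m + 2 ∈ α ω <;> simp [hIdef, h₁, h₂]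
  have e₂ : (fun ω => 0 + I m ω * Y (m + 2) ω)
      = fun ω => I m ω * (c * Y m ω) + (-d * (I m ω * (c * Y m ω))) * I (m + 1) ω := by
    ext ω
    rw [hsucc (m + 1), ← hIY, hd]
    push_cast
    ring
  have e₃ : (fun ω => I m ω * (c * Y m ω) + (-d * (I m ω * (c * Y m ω))) * Y (m + 1) ω)
      = fun ω => 0 + (c * Y m ω - d * (c * Y m ω) ^ 2) * I m ω := by
    ext ω
    linear_combination (-d * c * Y m ω) * hIY ω
  have hcY : ∀ ω, |c * Y m ω| ≤ |c| := fun ω => by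
    rw [abs_mul]
    exact mul_le_of_le_one_right (abs_nonneg _) (hYabs m ω)
  have hA : ∀ ω, |I m ω * (c * Y m ω)| ≤ |c| := fun ω => by
    rw [abs_mul]
    exact (mul_le_of_le_one_left (abs_nonneg _) (hIabs m ω)).trans (hcY ω)
  have hB : ∀ ω, |-d * (I m ω * (c * Y m ω))| ≤ |d| * |c| := fun ω => by
    rw [abs_mul, abs_neg]
    exact mul_le_mul_of_nonneg_left (hA ω) (abs_nonneg _)
  have hE : ∀ ω, |c * Y m ω - d * (c * Y m ω) ^ 2| ≤ |c| + |d| * |c| ^ 2 := fun ω => by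
    refine (abs_sub _ _).trans (add_le_add (hcY ω) ?_)
    rw [abs_mul, abs_pow]
    exact mul_le_mul_of_nonneg_left (pow_le_pow_left₀ (abs_nonneg _) (hcY ω) 2) (abs_nonneg _)
  have hAmeas : Measurable[sieveSigma α (m + 1)] fun ω => I m ω * (c * Y m ω) :=
    hImeas.mul (hYmeas'.const_mul c)
  have hEmeas : Measurable[sieveSigma α m] fun ω => c * Y m ω - d * (c * Y m ω) ^ 2 :=
    (hYmeas.const_mul c).sub (((hYmeas.const_mul c).pow_const 2).const_mul d)
  have hres : μ[fun ω => 0 + (c * Y m ω - d * (c * Y m ω) ^ 2) * Y m ω | sieveSigma α m]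
      = fun ω => 0 + (c * Y m ω - d * (c * Y m ω) ^ 2) * Y m ω := by
    have hmeas : Measurable[sieveSigma α m]
        fun ω => 0 + (c * Y m ω - d * (c * Y m ω) ^ 2) * Y m ω :=
      (hEmeas.mul hYmeas).const_add 0
    refine condExp_of_stronglyMeasurable (h.sieveSigma_le m) hmeas.stronglyMeasurable
      (Integrable.of_bound (hmeas.mono (h.sieveSigma_le m) le_rfl).aestronglyMeasurable
        (|c| + |d| * |c| ^ 2) (ae_of_all _ fun ω => ?_))
    rw [zero_add, Real.norm_eq_abs, abs_mul]
    exact (mul_le_of_le_one_right (abs_nonneg _) (hYabs m ω)).trans (hE ω)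
  have s₁ := h.condExp_affine (m := m) (n := m + 2) (by omega) (by omega)
    (a := fun _ => 0) (b := I m) measurable_const
    (hImeas.mono (sieveSigma_mono α (by omega)) le_rfl) (C := 0) (by simp) (hIabs m)
  have s₂ := h.condExp_affine (m := m) (n := m + 1) (by omega) (by omega)
    hAmeas (hAmeas.const_mul (-d)) hA hB
  have s₃ := h.condExp_affine (m := m) (n := m) hm le_rfl
    (a := fun _ => 0) measurable_const hEmeas (C := 0) (by simp) hE
  rw [e₁]
  refine s₁.trans ?_
  change μ[fun ω => 0 + I m ω * Y (m + 2) ω | sieveSigma α m] =ᵐ[μ] _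
  rw [e₂]
  refine s₂.trans ?_
  change μ[fun ω => I m ω * (c * Y m ω) + (-d * (I m ω * (c * Y m ω))) * Y (m + 1) ω
    | sieveSigma α m] =ᵐ[μ] _
  rw [e₃]
  refine s₃.trans ?_
  change μ[fun ω => 0 + (c * Y m ω - d * (c * Y m ω) ^ 2) * Y m ω | sieveSigma α m] =ᵐ[μ] _
  rw [hres]
  refine ae_of_all _ fun ω => ?_
  change 0 + (c * Y m ω - d * (c * Y m ω) ^ 2) * Y m ω
    = c * (Y m ω ^ 2 - d * c * Y m ω ^ 3)
  ring
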